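/- Assume MA(ω₁). Then every wide Aronszajn tree weakly embeds into a Lipschitz tree; that is, the class of Lipschitz trees is cofinal in the class of wide Aronszajn trees ordered by weak embeddability. -/

import Mathlib

universe u

open Cardinal Ordinal Set Classical

noncomputable def omega1 : Ordinal.{u} := (Cardinal.aleph 1).ord

/-- A tree: a partial order in which the set of strict predecessors of each element
is well-ordered by `<`. -/
def IsTree (T : Type u) [PartialOrder T] : Prop :=
  ∀ x : T, IsWellOrder {y : T // y < x} (fun a b => (a : T) < (b : T))

/-- The height of an element of a tree: the order type of its set of strict predecessors. -/
noncomputable def treeHeight {T : Type u} [PartialOrder T] (x : T) : Ordinal.{u} :=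
  if h : IsWellOrder {y : T // y < x} (fun a b => (a : T) < (b : T)) then
    @Ordinal.type _ _ h else 0

/-- The tree has height `ω₁`: every level below `ω₁` is nonempty and the level `ω₁` is empty
(equivalently, all heights are `< ω₁`). -/
def HasHeightOmega1 (T : Type u) [PartialOrder T] : Prop :=
  (∀ α : Ordinal.{u}, α < omega1.{u} → ∃ x : T, treeHeight x = α) ∧
    ∀ x : T, treeHeight x < omega1.{u}

def NoUncountableChain (T : Type u) [PartialOrder T] : Prop :=
  ∀ C : Set T, IsChain (· < ·) C → C.Countable

def IsWideAronszajn (T : Type u) [PartialOrder T] : Prop :=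
  IsTree T ∧ Cardinal.mk T = Cardinal.aleph.{u} 1 ∧ HasHeightOmega1 T ∧ NoUncountableChain T

def IsAronszajn (T : Type u) [PartialOrder T] : Prop :=
  IsTree T ∧ HasHeightOmega1 T ∧
    (∀ α : Ordinal.{u}, {x : T | treeHeight x = α}.Countable) ∧ NoUncountableChain T

def IsWeakEmbedding {T₁ T₂ : Type u} [PartialOrder T₁] [PartialOrder T₂] (f : T₁ → T₂) : Prop :=
  ∀ x y : T₁, x < y → f x < f y

/-- Martin's axiom for ℵ₁ many dense sets. -/
def MAomega1 : Prop :=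
  ∀ (P : Type u) [PartialOrder P], Nonempty P →
    (∀ A : Set P, (A.Pairwise fun p q => ¬ ∃ r, p ≤ r ∧ q ≤ r) → A.Countable) →
    ∀ 𝒟 : Set (Set P), Cardinal.mk 𝒟 ≤ Cardinal.aleph.{u} 1 →
      (∀ D ∈ 𝒟, ∀ p : P, ∃ q ∈ D, p ≤ q) →
      ∃ G : Set P, (∀ p ∈ G, ∀ q ∈ G, ∃ r ∈ G, p ≤ r ∧ q ≤ r) ∧
        (∀ p ∈ G, ∀ q, q ≤ p → q ∈ G) ∧ ∀ D ∈ 𝒟, (G ∩ D).Nonempty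

/-- A bundled partially ordered type. -/
structure PoType : Type (u + 1) where
  carrier : Type u
  str : PartialOrder carrier

attribute [instance] PoType.str

/-- `Δ(x, y)`: the order type of the set of common strict lower bounds of `x` and `y`. -/
noncomputable def treeDelta {T : Type u} [PartialOrder T] (x y : T) : Ordinal.{u} :=
  if h : IsWellOrder {z : T // z < x ∧ z < y} (fun a b => (a : T) < (b : T)) then
    @Ordinal.type _ _ h else 0

/-- A Lipschitz tree: an Aronszajn tree such that every height-preserving map on an
uncountable subset has an uncountable Lipschitz restriction. -/
def IsLipschitzTree (T : Type u) [PartialOrder T] : Prop :=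
  IsAronszajn T ∧
  ∀ (X : Set T) (f : T → T), ¬ X.Countable →
    (∀ x ∈ X, treeHeight (f x) = treeHeight x) →
    ∃ Y ⊆ X, ¬ Y.Countable ∧
      ∀ x ∈ Y, ∀ y ∈ Y, x ≠ y → treeDelta x y ≤ treeDelta (f x) (f y)

/-- `MA(ω₁)` for preorders and families of dense sets indexed by a type of size `≤ ℵ₁`. -/
theorem MAomega1.exists_directed (hMA : MAomega1.{u}) (P : Type u) [Preorder P] [Nonempty P]
    (hccc : ∀ A : Set P, ¬ A.Countable → ∃ p ∈ A, ∃ q ∈ A, p ≠ q ∧ ∃ r, p ≤ r ∧ q ≤ r)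
    (ι : Type u) (hι : Cardinal.mk ι ≤ Cardinal.aleph.{u} 1) (D : ι → Set P)
    (hD : ∀ i p, ∃ q ∈ D i, p ≤ q) :
    ∃ G : Set P, (∀ p ∈ G, ∀ q ∈ G, ∃ r ∈ G, p ≤ r ∧ q ≤ r) ∧ ∀ i, ∃ p ∈ G, p ∈ D i := by
  let Q := Antisymmetrization P (· ≤ ·)
  let π : P → Q := toAntisymmetrization (· ≤ ·)
  have hπ : ∀ p q : P, π p ≤ π q ↔ p ≤ q := fun _ _ =>
    toAntisymmetrization_le_toAntisymmetrization_iff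
  have hsurj : ∀ a : Q, π (ofAntisymmetrization (· ≤ ·) a) = a :=
    toAntisymmetrization_ofAntisymmetrization _
  have hc : ∀ A : Set Q, (A.Pairwise fun p q => ¬ ∃ r, p ≤ r ∧ q ≤ r) → A.Countable := by
    intro A hA
    by_contra hAc
    have hinj : Function.Injective (ofAntisymmetrization (α := P) (· ≤ ·)) :=
      Function.LeftInverse.injective hsurj
    obtain ⟨_, ⟨a, ha, rfl⟩, _, ⟨b, hb, rfl⟩, hab, r, h1, h2⟩ :=
      hccc (ofAntisymmetrization (· ≤ ·) '' A) fun h =>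
        hAc (Set.countable_of_injective_of_countable_image hinj.injOn h)
    refine hA ha hb (fun h => hab (by rw [h])) ⟨π r, ?_, ?_⟩
    · rw [← hsurj a, hπ]; exact h1
    · rw [← hsurj b, hπ]; exact h2
  obtain ⟨G, hG1, hG2, hG3⟩ := hMA Q (Nonempty.map π inferInstance) hc
    (Set.range fun i => π '' (D i)) (Cardinal.mk_range_le.trans hι) (by
      rintro _ ⟨i, rfl⟩ a
      obtain ⟨q, hq, hpq⟩ := hD i (ofAntisymmetrization (· ≤ ·) a)
      exact ⟨π q, ⟨q, hq, rfl⟩, by rw [← hsurj a, hπ]; exact hpq⟩)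
  refine ⟨π ⁻¹' G, ?_, ?_⟩
  · intro p hp q hq
    obtain ⟨r, hr, h1, h2⟩ := hG1 _ hp _ hq
    rw [← hsurj r, hπ] at h1 h2
    exact ⟨_, by rw [Set.mem_preimage, hsurj]; exact hr, h1, h2⟩
  · intro i
    obtain ⟨_, h1, p, hp, rfl⟩ := hG3 _ ⟨i, rfl⟩
    exact ⟨p, h1, hp⟩

theorem exists_uncountable_fiber {α β : Type*} [Countable β] {S : Set α} (hS : ¬ S.Countable)
    (g : α → β) : ∃ b, ¬ {a ∈ S | g a = b}.Countable := by
  by_contra! h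
  refine hS ((Set.countable_iUnion h).mono fun a ha => ?_)
  exact Set.mem_iUnion.2 ⟨g a, ha, rfl⟩

theorem Set.exists_mem_of_not_countable {α : Type*} {S T : Set α} (hS : ¬ S.Countable)
    (hT : T.Countable) : ∃ a ∈ S, a ∉ T := by
  by_contra! h
  exact hS (hT.mono h)

/-- A tree-like order: predecessors of a point are pairwise comparable, each point has countably
many predecessors, and there is no uncountable chain. -/
structure IsNarrowTree (T : Type*) [PartialOrder T] : Prop where
  total_below : ∀ x y z : T, x ≤ z → y ≤ z → x ≤ y ∨ y ≤ x
  countable_below : ∀ x : T, (Set.Iic x).Countable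
  countable_of_chain : ∀ C : Set T, IsChain (· < ·) C → C.Countable

/-- Baumgartner's lemma: an uncountable point-countable family of finite sets
has two members all of whose elements are incomparable. -/
theorem IsNarrowTree.exists_incomparable {T : Type*} [PartialOrder T] (hT : IsNarrowTree T)
    {ι : Type*} {S : Set ι} (hS : ¬ S.Countable) (a : ι → Finset T)
    (ha : ∀ x, {i ∈ S | x ∈ a i}.Countable) :
    ∃ i ∈ S, ∃ j ∈ S, i ≠ j ∧ ∀ x ∈ a i, ∀ y ∈ a j, ¬ x ≤ y ∧ ¬ y ≤ x := by
  obtain ⟨n, hn⟩ := exists_uncountable_fiber hS fun i => (a i).card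
  set S' := {i ∈ S | (a i).card = n}
  by_contra! hcon
  let e : ∀ i : S', Fin n ≃ a i := fun i => (Finset.equivFinOfCardEq i.2.2).symm
  have hunc : ¬ (Set.univ : Set S').Countable := by
    rwa [Set.countable_univ_iff, Set.countable_coe_iff]
  have hne : (Filter.cocountable : Filter S').NeBot := by
    refine ⟨fun h => hunc ?_⟩
    have := Filter.empty_mem_iff_bot.2 h
    rwa [Filter.mem_cocountable, Set.compl_empty] at this
  let U : Ultrafilter S' := Ultrafilter.of Filter.cocountable
  have hU : ∀ s : Set S', s.Countable → ∀ᶠ j in (U : Filter S'), j ∉ s := fun s hs =>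
    Ultrafilter.of_le _ (Filter.mem_cocountable.2 (by rwa [← Set.compl_def, compl_compl]))
  have hfib : ∀ x, {j : S' | x ∈ a j}.Countable := fun x => by
    refine Set.Countable.mono (fun j hj => ?_)
      ((ha x).preimage (Subtype.val_injective (p := (· ∈ S'))))
    exact ⟨j.2.1, hj⟩
  have key : ∀ i : S', ∃ kl : Fin n × Fin n,
      ∀ᶠ j in (U : Filter S'), (e i kl.1 : T) ≤ e j kl.2 := by
    intro i
    rw [← Ultrafilter.eventually_exists_iff]
    have hcount : ({i} ∪ ⋃ y ∈ ⋃ k, Set.Iic (e i k : T), {j : S' | y ∈ a j}).Countable :=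
      (Set.countable_singleton i).union (Set.Countable.biUnion
        (Set.countable_iUnion fun k => hT.countable_below _) fun y _ => hfib y)
    filter_upwards [hU _ hcount] with j hj
    have hij : (i : ι) ≠ j := fun h => hj (Or.inl (Subtype.ext h.symm))
    obtain ⟨x, hx, y, hy, hxy⟩ := hcon i i.2.1 j j.2.1 hij
    have hk : (e i ((e i).symm ⟨x, hx⟩) : T) = x := by simp
    have hl : (e j ((e j).symm ⟨y, hy⟩) : T) = y := by simp
    refine ⟨((e i).symm ⟨x, hx⟩, (e j).symm ⟨y, hy⟩), ?_⟩
    rw [hk, hl]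
    by_contra hle
    refine hj (Or.inr (Set.mem_biUnion (x := y) (Set.mem_iUnion.2 ⟨(e i).symm ⟨x, hx⟩, ?_⟩) hy))
    rw [hk]
    exact hxy hle
  choose kl hkl using key
  obtain ⟨⟨k, l⟩, hQ⟩ := exists_uncountable_fiber hunc kl
  set Q := {i ∈ (Set.univ : Set S') | kl i = (k, l)}
  have hchain : IsChain (· < ·) ((fun i : S' => (e i k : T)) '' Q) := by
    rintro _ ⟨i, hi, rfl⟩ _ ⟨i', hi', rfl⟩ hne'
    have h1 := hkl i
    have h2 := hkl i'
    rw [hi.2] at h1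
    rw [hi'.2] at h2
    obtain ⟨j, hj1, hj2⟩ := (h1.and h2).exists
    rcases hT.total_below _ _ _ hj1 hj2 with h | h
    · exact Or.inl (lt_of_le_of_ne h hne')
    · exact Or.inr (lt_of_le_of_ne h hne'.symm)
  refine hQ (Set.Countable.mono (fun i hi => ?_)
    ((hT.countable_of_chain _ hchain).biUnion fun x _ => hfib x))
  exact Set.mem_biUnion ⟨i, hi, rfl⟩ (e i k).2

/-- A weak Δ-system lemma combined with Baumgartner's lemma. -/
theorem IsNarrowTree.exists_root {T : Type*} [PartialOrder T] (hT : IsNarrowTree T)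
    {ι : Type*} {S : Set ι} (hS : ¬ S.Countable) (a : ι → Finset T) :
    ∃ (R : Finset T) (J : Set ι), J ⊆ S ∧ ¬ J.Countable ∧ (∀ i ∈ J, R ⊆ a i) ∧
      ∀ K ⊆ J, ¬ K.Countable → ∃ i ∈ K, ∃ j ∈ K, i ≠ j ∧
        ∀ x ∈ a i, ∀ y ∈ a j, (x ≤ y ∨ y ≤ x) → x ∈ R ∨ y ∈ R := by
  obtain ⟨n, hn⟩ := exists_uncountable_fiber hS fun i => (a i).card
  set S' := {i ∈ S | (a i).card = n}
  let p : ℕ → Prop := fun m => ∃ R : Finset T, R.card = m ∧ ¬ {i ∈ S' | R ⊆ a i}.Countable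
  have hp0 : p 0 := ⟨∅, rfl, by simpa using hn⟩
  have hpn : ∀ m, p m → m ≤ n := by
    rintro m ⟨R, rfl, hR⟩
    obtain ⟨i, hi, -⟩ := Set.exists_mem_of_not_countable hR Set.countable_empty
    exact (Finset.card_le_card hi.2).trans hi.1.2.le
  obtain ⟨R, hRc, hR⟩ : p (Nat.findGreatest p n) := Nat.findGreatest_spec (Nat.zero_le n) hp0
  have hmax : ∀ x ∉ R, {i ∈ S' | insert x R ⊆ a i}.Countable := by
    intro x hx
    by_contra hc
    have h1 : p (R.card + 1) := ⟨insert x R, Finset.card_insert_of_notMem hx, hc⟩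
    have := Nat.le_findGreatest (hpn _ h1) h1
    omega
  refine ⟨R, {i ∈ S' | R ⊆ a i}, fun i hi => hi.1.1, hR, fun i hi => hi.2, fun K hK hKc => ?_⟩
  obtain ⟨i, hi, j, hj, hij, h⟩ := hT.exists_incomparable hKc (fun i => a i \ R) (by
    intro x
    by_cases hx : x ∈ R
    · simp [hx]
    · refine (hmax x hx).mono fun i hi => ?_
      exact ⟨(hK hi.1).1, Finset.insert_subset (Finset.mem_sdiff.1 hi.2).1 (hK hi.1).2⟩)
  refine ⟨i, hi, j, hj, hij, fun x hx y hy hxy => ?_⟩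
  by_contra! hn
  have := h x (Finset.mem_sdiff.2 ⟨hx, hn.1⟩) y (Finset.mem_sdiff.2 ⟨hy, hn.2⟩)
  tauto

/-- A finite approximation to a specializing function of `T`. -/
structure SpecializingCondition (T : Type u) [PartialOrder T] : Type u where
  support : Finset T
  toFun : T → ℕ
  ne_of_lt : ∀ x ∈ support, ∀ y ∈ support, x < y → toFun x ≠ toFun y

instance (T : Type u) [PartialOrder T] : Preorder (SpecializingCondition T) where
  le p q := p.support ⊆ q.support ∧ ∀ x ∈ p.support, q.toFun x = p.toFun x
  le_refl p := ⟨subset_rfl, fun _ _ => rfl⟩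
  le_trans p q r h1 h2 :=
    ⟨h1.1.trans h2.1, fun x hx => (h2.2 x (h1.1 hx)).trans (h1.2 x hx)⟩

theorem IsNarrowTree.specializingCondition_ccc {T : Type u} [PartialOrder T] (hT : IsNarrowTree T)
    (A : Set (SpecializingCondition T)) (hA : ¬ A.Countable) :
    ∃ p ∈ A, ∃ q ∈ A, p ≠ q ∧ ∃ r, p ≤ r ∧ q ≤ r := by
  obtain ⟨R, J, hJA, hJ, hRJ, hJinc⟩ := hT.exists_root hA SpecializingCondition.support
  obtain ⟨v, hv⟩ := exists_uncountable_fiber hJ fun p => fun r : R => p.toFun r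
  obtain ⟨p, hp, q, hq, hpq, hinc⟩ := hJinc _ (fun p hp => hp.1) hv
  have hval : ∀ r ∈ R, p.toFun r = q.toFun r := fun r hr =>
    congrFun (hp.2.trans hq.2.symm) ⟨r, hr⟩
  have hroot : ∀ x ∈ p.support, x ∈ q.support → x ∈ R := fun x hx hy => by
    simpa using hinc x hx x hy (Or.inl le_rfl)
  refine ⟨p, hJA hp.1, q, hJA hq.1, hpq,
    ⟨p.support ∪ q.support, fun x => if x ∈ p.support then p.toFun x else q.toFun x, ?_⟩, ?_, ?_⟩
  · intro x hx y hy hxy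
    have hRp := hRJ p hp.1
    have hRq := hRJ q hq.1
    have hpp := p.ne_of_lt x
    have hqq := q.ne_of_lt x
    have h1 := hinc x
    have h2 := hinc y
    rw [Finset.mem_union] at hx hy
    have hle := hxy.le
    by_cases hxp : x ∈ p.support <;> by_cases hyp : y ∈ p.support <;>
      simp only [hxp, hyp, if_true, if_false]
    · exact hpp hxp y hyp hxy
    · have hyq : y ∈ q.support := by tauto
      have hxR : x ∈ R := by
        rcases h1 hxp y hyq (Or.inl hle) with h | h
        · exact h
        · exact absurd (hRp h) hyp
      rw [hval x hxR]
      exact hqq (hRq hxR) y hyq hxy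
    · have hxq : x ∈ q.support := by tauto
      have hyR : y ∈ R := by
        rcases h2 hyp x hxq (Or.inr hle) with h | h
        · exact h
        · exact absurd (hRp h) hxp
      rw [hval y hyR]
      exact hqq hxq y (hRq hyR) hxy
    · exact hqq (by tauto) y (by tauto) hxy
  · exact ⟨Finset.subset_union_left, fun x hx => by simp [hx]⟩
  · refine ⟨Finset.subset_union_right, fun x hx => ?_⟩
    by_cases hxp : x ∈ p.support
    · simp [hxp, hval x (hroot x hxp hx)]
    · simp [hxp]

theorem IsNarrowTree.exists_specializing (hMA : MAomega1.{u}) {T : Type u} [PartialOrder T]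
    (hT : IsNarrowTree T) (hcard : Cardinal.mk T ≤ Cardinal.aleph.{u} 1) :
    ∃ g : T → ℕ, ∀ x y, x < y → g x ≠ g y := by
  have : Nonempty (SpecializingCondition T) := ⟨⟨∅, fun _ => 0, by simp⟩⟩
  obtain ⟨G, hG, hGD⟩ := hMA.exists_directed (SpecializingCondition T)
    hT.specializingCondition_ccc T hcard (fun x => {p | x ∈ p.support}) (by
      intro x p
      by_cases hx : x ∈ p.support
      · exact ⟨p, hx, le_rfl⟩
      let N := p.support.sup p.toFun + 1
      have hN : ∀ y ∈ p.support, p.toFun y < N := fun y hy =>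
        Nat.lt_succ_of_le (Finset.le_sup (f := p.toFun) hy)
      refine ⟨⟨insert x p.support, fun y => if y = x then N else p.toFun y, ?_⟩,
        Finset.mem_insert_self _ _, Finset.subset_insert _ _, fun y hy => ?_⟩
      · intro y hy z hz hyz
        rw [Finset.mem_insert] at hy hz
        rcases hy with rfl | hy <;> rcases hz with rfl | hz
        · exact absurd hyz (lt_irrefl _)
        · have := hN z hz
          simp only [if_true, if_neg hyz.ne']
          omega
        · have := hN y hy
          simp only [if_true, if_neg hyz.ne]
          omega
        · rw [if_neg (ne_of_mem_of_not_mem hy hx), if_neg (ne_of_mem_of_not_mem hz hx)]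
          exact p.ne_of_lt y hy z hz hyz
      · exact if_neg (ne_of_mem_of_not_mem hy hx))
  choose p hpG hp using hGD
  refine ⟨fun x => (p x).toFun x, fun x y hxy => ?_⟩
  obtain ⟨r, -, h1, h2⟩ := hG _ (hpG x) _ (hpG y)
  show (p x).toFun x ≠ (p y).toFun y
  rw [← h1.2 x (hp x), ← h2.2 y (hp y)]
  exact r.ne_of_lt x (h1.1 (hp x)) y (h2.1 (hp y)) hxy

section Coherent

variable {T W : Type u} [PartialOrder T] [LinearOrder W]

/-- `π z ξ` is the least element below `z` of rank greater than `ξ`. -/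
def IsLeastProjection (δ : T → W) (π : T → W → T) : Prop :=
  ∀ z ξ, ξ < δ z → π z ξ ≤ z ∧ ξ < δ (π z ξ) ∧ ∀ x ≤ z, ξ < δ x → π z ξ ≤ x

theorem IsNarrowTree.exists_isLeastProjection [WellFoundedLT W] (hT : IsNarrowTree T) {δ : T → W}
    (hδ : StrictMono δ) : ∃ π, IsLeastProjection δ π := by
  have h : ∀ z ξ, ∃ w, ξ < δ z → w ≤ z ∧ ξ < δ w ∧ ∀ x ≤ z, ξ < δ x → w ≤ x := by
    intro z ξ
    by_cases hz : ξ < δ z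
    · obtain ⟨w, ⟨hw1, hw2⟩, hmin⟩ := WellFounded.has_min (InvImage.wf δ (wellFounded_lt (α := W)))
        {x | x ≤ z ∧ ξ < δ x} ⟨z, le_rfl, hz⟩
      refine ⟨w, fun _ => ⟨hw1, hw2, fun x hx hξ => ?_⟩⟩
      rcases hT.total_below _ _ _ hw1 hx with h | h
      · exact h
      · rcases h.eq_or_lt with h | h
        · exact h.ge
        · exact absurd (hδ h) (hmin x ⟨hx, hξ⟩)
    · exact ⟨z, fun h => absurd h hz⟩
  choose π hπ using h
  exact ⟨π, hπ⟩

theorem IsLeastProjection.eq_of_le {δ : T → W} {π : T → W → T} (hπ : IsLeastProjection δ π)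
    (hδ : StrictMono δ) {x z : T} (hxz : x ≤ z) {ξ : W} (hξ : ξ < δ x) : π x ξ = π z ξ := by
  have hz : ξ < δ z := hξ.trans_le (hδ.monotone hxz)
  obtain ⟨h1, h2, h3⟩ := hπ x ξ hξ
  obtain ⟨h4, h5, h6⟩ := hπ z ξ hz
  exact le_antisymm (h3 _ (h6 x hxz hξ) h5) (h6 _ (h1.trans hxz) h2)

/-- A finite approximation to a coherent finite-to-one family of functions indexed by `T`. -/
structure CoherentCondition (δ : T → W) (π : T → W → T) : Type u where
  nodes : Finset T
  coords : Finset W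
  bound : ℕ
  label : T → W → ℕ
  closed : ∀ z ∈ nodes, ∀ ξ ∈ coords, ξ < δ z → π z ξ ∈ nodes

variable {δ : T → W} {π : T → W → T}

/-- The value at `ξ` of the function attached to `z`. -/
def CoherentCondition.val (p : CoherentCondition δ π) (z : T) (ξ : W) : ℕ :=
  p.label (π z ξ) ξ

instance : Preorder (CoherentCondition δ π) where
  le p q := p.nodes ⊆ q.nodes ∧ p.coords ⊆ q.coords ∧ p.bound ≤ q.bound ∧
    (∀ z ∈ p.nodes, ∀ ξ ∈ p.coords, ξ < δ z → q.val z ξ = p.val z ξ) ∧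
    ∀ ξ ∈ q.coords, ξ ∉ p.coords → ∃ c, p.bound < c ∧ ∀ z ∈ p.nodes, ξ < δ z → q.val z ξ = c
  le_refl p := ⟨subset_rfl, subset_rfl, le_rfl, fun _ _ _ _ _ => rfl, fun _ h h' => absurd h h'⟩
  le_trans p q r := by
    rintro ⟨h1, h2, h3, h4, h5⟩ ⟨k1, k2, k3, k4, k5⟩
    refine ⟨h1.trans k1, h2.trans k2, h3.trans k3, fun z hz ξ hξ hlt => ?_, fun ξ hξ hξp => ?_⟩
    · rw [k4 z (h1 hz) ξ (h2 hξ) hlt, h4 z hz ξ hξ hlt]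
    · by_cases hξq : ξ ∈ q.coords
      · obtain ⟨c, hc, hval⟩ := h5 ξ hξq hξp
        exact ⟨c, hc, fun z hz hlt => by rw [k4 z (h1 hz) ξ hξq hlt, hval z hz hlt]⟩
      · obtain ⟨c, hc, hval⟩ := k5 ξ hξ hξq
        exact ⟨c, h3.trans_lt hc, fun z hz hlt => hval z (h1 hz) hlt⟩

theorem CoherentCondition.exists_ge_mem_nodes (hδ : StrictMono δ) (hπ : IsLeastProjection δ π)
    (p : CoherentCondition δ π) (x : T) (n : ℕ) : ∃ q, p ≤ q ∧ x ∈ q.nodes ∧ n ≤ q.bound := by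
  refine ⟨⟨insert x (p.nodes ∪ (p.coords.filter (· < δ x)).image (π x)), p.coords, max p.bound n,
    p.label, ?_⟩, ⟨?_, subset_rfl, le_max_left _ _, fun _ _ _ _ _ => rfl,
      fun _ h h' => absurd h h'⟩, Finset.mem_insert_self _ _, le_max_right _ _⟩
  · intro z hz ξ hξ hlt
    have hx : ξ < δ x → π x ξ ∈ insert x (p.nodes ∪ (p.coords.filter (· < δ x)).image (π x)) :=
      fun h => Finset.mem_insert_of_mem (Finset.mem_union_right _
        (Finset.mem_image_of_mem _ (Finset.mem_filter.2 ⟨hξ, h⟩)))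
    rcases Finset.mem_insert.1 hz with rfl | hz
    · exact hx hlt
    rcases Finset.mem_union.1 hz with hz | hz
    · exact Finset.mem_insert_of_mem (Finset.mem_union_left _ (p.closed z hz ξ hξ hlt))
    · obtain ⟨η, hη, rfl⟩ := Finset.mem_image.1 hz
      have hle := (hπ x η (Finset.mem_filter.1 hη).2).1
      rw [hπ.eq_of_le hδ hle hlt]
      exact hx (hlt.trans_le (hδ.monotone hle))
  · exact Finset.subset_union_left.trans (Finset.subset_insert _ _)

theorem CoherentCondition.exists_ge_mem_coords (hδ : StrictMono δ) (hπ : IsLeastProjection δ π)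
    (p : CoherentCondition δ π) (ξ : W) : ∃ q, p ≤ q ∧ ξ ∈ q.coords := by
  by_cases hξ : ξ ∈ p.coords
  · exact ⟨p, le_rfl, hξ⟩
  refine ⟨⟨p.nodes ∪ (p.nodes.filter (ξ < δ ·)).image (π · ξ), insert ξ p.coords, p.bound,
    fun w η => if η = ξ then p.bound + 1 else p.label w η, ?_⟩,
    ⟨Finset.subset_union_left, Finset.subset_insert _ _, le_rfl, ?_, ?_⟩,
      Finset.mem_insert_self _ _⟩
  · intro z hz η hη hlt
    obtain ⟨z₀, hz₀, hle⟩ : ∃ z₀ ∈ p.nodes, z ≤ z₀ := by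
      rcases Finset.mem_union.1 hz with hz | hz
      · exact ⟨z, hz, le_rfl⟩
      · obtain ⟨z₀, hz₀, rfl⟩ := Finset.mem_image.1 hz
        rw [Finset.mem_filter] at hz₀
        exact ⟨z₀, hz₀.1, (hπ z₀ ξ hz₀.2).1⟩
    have hlt₀ := hlt.trans_le (hδ.monotone hle)
    rw [hπ.eq_of_le hδ hle hlt]
    rcases Finset.mem_insert.1 hη with rfl | hη
    · exact Finset.mem_union_right _
        (Finset.mem_image_of_mem (π · η) (Finset.mem_filter.2 ⟨hz₀, hlt₀⟩))
    · exact Finset.mem_union_left _ (p.closed z₀ hz₀ η hη hlt₀)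
  · intro z _ η hη _
    exact if_neg (ne_of_mem_of_not_mem hη hξ)
  · intro η hη hηp
    rcases Finset.mem_insert.1 hη with rfl | hη
    · exact ⟨p.bound + 1, Nat.lt_succ_self _, fun z _ _ => if_pos rfl⟩
    · exact absurd hη hηp

theorem CoherentCondition.exists_amalgam (hδ : StrictMono δ) (hπ : IsLeastProjection δ π)
    (p q : CoherentCondition δ π) (R : Finset T)
    (hinc : ∀ x ∈ p.nodes, ∀ y ∈ q.nodes, (x ≤ y ∨ y ≤ x) → x ∈ R ∨ y ∈ R)
    (hcoords : ∀ ξ, ∀ r ∈ R, ξ < δ r → (ξ ∈ p.coords ↔ ξ ∈ q.coords))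
    (hlabel : ∀ r ∈ R, ∀ ξ ∈ p.coords, ξ < δ r → p.label r ξ = q.label r ξ) :
    ∃ r, p ≤ r ∧ q ≤ r := by
  let N := max p.bound q.bound + 1
  let F := p.nodes ∪ q.nodes
  let D := p.coords ∪ q.coords
  refine ⟨⟨F ∪ ((F ×ˢ D).filter fun a => a.2 < δ a.1).image fun a => π a.1 a.2, D, N,
    fun w ξ => if w ∈ p.nodes ∧ ξ ∈ p.coords then p.label w ξ
      else if w ∈ q.nodes ∧ ξ ∈ q.coords then q.label w ξ else N, ?_⟩,
    ⟨Finset.subset_union_left.trans Finset.subset_union_left, Finset.subset_union_left,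
      (le_max_left _ _).trans (Nat.le_succ _), ?_, ?_⟩,
    ⟨Finset.subset_union_right.trans Finset.subset_union_left, Finset.subset_union_right,
      (le_max_right _ _).trans (Nat.le_succ _), ?_, ?_⟩⟩
  · intro z hz ξ hξ hlt
    obtain ⟨z₀, hz₀, hle⟩ : ∃ z₀ ∈ F, z ≤ z₀ := by
      rcases Finset.mem_union.1 hz with hz | hz
      · exact ⟨z, hz, le_rfl⟩
      · obtain ⟨⟨z₀, η⟩, hz₀, rfl⟩ := Finset.mem_image.1 hz
        rw [Finset.mem_filter, Finset.mem_product] at hz₀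
        exact ⟨z₀, hz₀.1.1, (hπ z₀ η hz₀.2).1⟩
    rw [hπ.eq_of_le hδ hle hlt]
    refine Finset.mem_union_right _ (Finset.mem_image_of_mem (fun a : T × W => π a.1 a.2)
      (a := (z₀, ξ)) ?_)
    simp only [Finset.mem_filter, Finset.mem_product]
    exact ⟨⟨hz₀, hξ⟩, hlt.trans_le (hδ.monotone hle)⟩
  · intro z hz ξ hξ hlt
    exact if_pos ⟨p.closed z hz ξ hξ hlt, hξ⟩
  · intro ξ hξ hξp
    refine ⟨N, Nat.lt_succ_of_le (le_max_left _ _), fun z hz hlt => ?_⟩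
    refine (if_neg fun h => hξp h.2).trans (if_neg fun h => ?_)
    obtain ⟨hle, hlt', -⟩ := hπ z ξ hlt
    rcases hinc z hz _ h.1 (Or.inr hle) with hR | hR
    · exact hξp ((hcoords ξ _ hR hlt).2 h.2)
    · exact hξp ((hcoords ξ _ hR hlt').2 h.2)
  · intro z hz ξ hξ hlt
    obtain ⟨hle, hlt', -⟩ := hπ z ξ hlt
    have hq := q.closed z hz ξ hξ hlt
    by_cases h : π z ξ ∈ p.nodes ∧ ξ ∈ p.coords
    · refine (if_pos h).trans (hlabel _ ?_ ξ h.2 hlt')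
      simpa using hinc _ h.1 _ hq (Or.inl le_rfl)
    · exact (if_neg h).trans (if_pos ⟨hq, hξ⟩)
  · intro ξ hξ hξq
    refine ⟨N, Nat.lt_succ_of_le (le_max_right _ _), fun z hz hlt => ?_⟩
    refine (if_neg fun h => ?_).trans (if_neg fun h => hξq h.2)
    obtain ⟨hle, hlt', -⟩ := hπ z ξ hlt
    rcases hinc _ h.1 z hz (Or.inl hle) with hR | hR
    · exact hξq ((hcoords ξ _ hR hlt').1 h.2)
    · exact hξq ((hcoords ξ _ hR hlt).1 h.2)

theorem IsNarrowTree.coherentCondition_ccc (hT : IsNarrowTree T)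
    (hW : ∀ w : W, (Set.Iio w).Countable) (hδ : StrictMono δ) (hπ : IsLeastProjection δ π)
    (A : Set (CoherentCondition δ π)) (hA : ¬ A.Countable) :
    ∃ p ∈ A, ∃ q ∈ A, p ≠ q ∧ ∃ r, p ≤ r ∧ q ≤ r := by
  obtain ⟨R, J, hJA, hJ, hRJ, hJinc⟩ := hT.exists_root hA CoherentCondition.nodes
  let E : Set W := ⋃ r ∈ R, Set.Iio (δ r)
  have hE : E.Countable := R.countable_toSet.biUnion fun r _ => hW (δ r)
  have : Countable E := hE.to_subtype
  obtain ⟨C, hC⟩ := exists_uncountable_fiber hJ fun p => p.coords.subtype (· ∈ E)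
  obtain ⟨v, hv⟩ := exists_uncountable_fiber hC fun p => fun (r : R) (ξ : C) => p.label r ξ
  obtain ⟨p, hp, q, hq, hpq, hinc⟩ := hJinc _ (fun p hp => hp.1.1) hv
  have hmem : ∀ ξ, ∀ r ∈ R, ξ < δ r → ξ ∈ E := fun ξ r hr hlt => Set.mem_biUnion hr hlt
  have hpC : ∀ ξ (h : ξ ∈ E), ξ ∈ p.coords ↔ (⟨ξ, h⟩ : E) ∈ C := fun ξ h => by
    rw [← hp.1.2, Finset.mem_subtype]
  have hqC : ∀ ξ (h : ξ ∈ E), ξ ∈ q.coords ↔ (⟨ξ, h⟩ : E) ∈ C := fun ξ h => by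
    rw [← hq.1.2, Finset.mem_subtype]
  refine ⟨p, hJA hp.1.1, q, hJA hq.1.1, hpq,
    CoherentCondition.exists_amalgam hδ hπ p q R hinc ?_ ?_⟩
  · intro ξ r hr hlt
    rw [hpC ξ (hmem ξ r hr hlt), hqC]
  · intro r hr ξ hξ hlt
    exact congrFun (congrFun (hp.2.trans hq.2.symm) ⟨r, hr⟩)
      ⟨⟨ξ, hmem ξ r hr hlt⟩, (hpC ξ (hmem ξ r hr hlt)).1 hξ⟩

/-- Under `MA(ω₁)` a narrow tree ranked into `W` carries an increasing coherent family
of finite-to-one functions. -/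
theorem IsNarrowTree.exists_coherent (hMA : MAomega1.{u}) [WellFoundedLT W] [Nonempty T]
    [Nonempty W] (hT : IsNarrowTree T)
    (hTc : Cardinal.mk T ≤ Cardinal.aleph.{u} 1) (hWc : Cardinal.mk W ≤ Cardinal.aleph.{u} 1)
    (hW : ∀ w : W, (Set.Iio w).Countable) (hδ : StrictMono δ) :
    ∃ t : T → W → ℕ, (∀ x y, x < y → ∀ ξ < δ x, t x ξ = t y ξ) ∧
      (∀ x y, {ξ | ξ < δ x ∧ ξ < δ y ∧ t x ξ ≠ t y ξ}.Finite) ∧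
      ∀ x n, {ξ | ξ < δ x ∧ t x ξ = n}.Finite := by
  obtain ⟨π, hπ⟩ := hT.exists_isLeastProjection hδ
  have : Nonempty (CoherentCondition δ π) := ⟨⟨∅, ∅, 0, fun _ _ => 0, by simp⟩⟩
  obtain ⟨G, hG, hGD⟩ := hMA.exists_directed (CoherentCondition δ π)
    (hT.coherentCondition_ccc hW hδ hπ) (T × W × ULift.{u} ℕ) (by
      have h0 : Cardinal.aleph0.{u} ≤ Cardinal.aleph 1 := Cardinal.aleph0_le_aleph 1
      simp only [Cardinal.mk_prod, Cardinal.lift_id, Cardinal.mk_uLift, Cardinal.mk_nat,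
        Cardinal.lift_aleph0]
      exact Cardinal.mul_le_of_le h0 hTc (Cardinal.mul_le_of_le h0 hWc h0))
    (fun i => {p | i.1 ∈ p.nodes ∧ i.2.1 ∈ p.coords ∧ i.2.2.down ≤ p.bound}) (by
      rintro ⟨x, ξ, ⟨n⟩⟩ p
      obtain ⟨q, hpq, hx, hn⟩ := p.exists_ge_mem_nodes hδ hπ x n
      obtain ⟨r, hqr, hξ⟩ := q.exists_ge_mem_coords hδ hπ ξ
      exact ⟨r, ⟨hqr.1 hx, hξ, hn.trans hqr.2.2.1⟩, hpq.trans hqr⟩)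
  choose p hpG hp using hGD
  let c : T → W → CoherentCondition δ π := fun x ξ => p (x, ξ, ⟨0⟩)
  have ht : ∀ x ξ, ξ < δ x → ∀ q ∈ G, x ∈ q.nodes → ξ ∈ q.coords →
      (c x ξ).val x ξ = q.val x ξ := by
    intro x ξ hlt q hq hx hξ
    obtain ⟨r, -, h1, h2⟩ := hG _ (hpG (x, ξ, ⟨0⟩)) q hq
    rw [← h2.2.2.2.1 x hx ξ hξ hlt]
    exact (h1.2.2.2.1 x (hp (x, ξ, ⟨0⟩)).1 ξ (hp (x, ξ, ⟨0⟩)).2.1 hlt).symm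
  refine ⟨fun x ξ => (c x ξ).val x ξ, ?_, ?_, ?_⟩
  · intro x y hxy ξ hlt
    have hlt' : ξ < δ y := hlt.trans (hδ hxy)
    obtain ⟨r, hr, h1, h2⟩ := hG _ (hpG (x, ξ, ⟨0⟩)) _ (hpG (y, ξ, ⟨0⟩))
    have hξ := h1.2.1 (hp (x, ξ, ⟨0⟩)).2.1
    show (c x ξ).val x ξ = (c y ξ).val y ξ
    rw [ht x ξ hlt r hr (h1.1 (hp (x, ξ, ⟨0⟩)).1) hξ,
      ht y ξ hlt' r hr (h2.1 (hp (y, ξ, ⟨0⟩)).1) hξ, CoherentCondition.val,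
      CoherentCondition.val, hπ.eq_of_le hδ hxy.le hlt]
  · intro x y
    obtain ⟨ξ₀⟩ := ‹Nonempty W›
    obtain ⟨q, hq, h1, h2⟩ := hG _ (hpG (x, ξ₀, ⟨0⟩)) _ (hpG (y, ξ₀, ⟨0⟩))
    have hxq := h1.1 (hp (x, ξ₀, ⟨0⟩)).1
    have hyq := h2.1 (hp (y, ξ₀, ⟨0⟩)).1
    refine q.coords.finite_toSet.subset ?_
    rintro ξ ⟨hξx, hξy, hne⟩
    by_contra hξ
    obtain ⟨r, hr, k1, k2⟩ := hG q hq _ (hpG (x, ξ, ⟨0⟩))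
    have hξr := k2.2.1 (hp (x, ξ, ⟨0⟩)).2.1
    obtain ⟨b, -, hb⟩ := k1.2.2.2.2 ξ hξr hξ
    refine hne ?_
    show (c x ξ).val x ξ = (c y ξ).val y ξ
    rw [ht x ξ hξx r hr (k1.1 hxq) hξr, ht y ξ hξy r hr (k1.1 hyq) hξr, hb x hxq hξx,
      hb y hyq hξy]
  · intro x n
    obtain ⟨ξ₀⟩ := ‹Nonempty W›
    set q := p (x, ξ₀, ⟨n⟩)
    have hxq := (hp (x, ξ₀, ⟨n⟩)).1
    have hnq := (hp (x, ξ₀, ⟨n⟩)).2.2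
    refine q.coords.finite_toSet.subset ?_
    rintro ξ ⟨hlt, heq⟩
    by_contra hξ
    obtain ⟨r, hr, k1, k2⟩ := hG q (hpG _) _ (hpG (x, ξ, ⟨0⟩))
    have hξr := k2.2.1 (hp (x, ξ, ⟨0⟩)).2.1
    obtain ⟨b, hb', hb⟩ := k1.2.2.2.2 ξ hξr hξ
    have heq' : (c x ξ).val x ξ = n := heq
    rw [ht x ξ hlt r hr (k1.1 hxq) hξr, hb x hxq hlt] at heq'
    exact (hnq.trans_lt hb').ne' heq'

end Coherent

section InitialSegments

variable {T W : Type u} [LinearOrder W]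

/-- The tree of all initial segments of the functions `t x ↾ δ x`. -/
@[ext]
structure CoherentTree (δ : T → W) (t : T → W → ℕ) : Type u where
  height : W
  toFun : W → ℕ
  exists_eq : ∃ x, height ≤ δ x ∧ ∀ ξ, toFun ξ = if ξ < height then t x ξ else 0

variable {δ : T → W} {t : T → W → ℕ}

namespace CoherentTree

theorem toFun_of_le (a : CoherentTree δ t) {ξ : W} (h : a.height ≤ ξ) : a.toFun ξ = 0 := by
  obtain ⟨x, -, hx⟩ := a.exists_eq
  rw [hx, if_neg (not_lt.2 h)]

instance : PartialOrder (CoherentTree δ t) where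
  le a b := a.height ≤ b.height ∧ ∀ ξ < a.height, a.toFun ξ = b.toFun ξ
  le_refl a := ⟨le_rfl, fun _ _ => rfl⟩
  le_trans a b c h k :=
    ⟨h.1.trans k.1, fun ξ hξ => (h.2 ξ hξ).trans (k.2 ξ (hξ.trans_le h.1))⟩
  le_antisymm a b h k := by
    have hh := le_antisymm h.1 k.1
    refine CoherentTree.ext hh (funext fun ξ => ?_)
    rcases lt_or_ge ξ a.height with hξ | hξ
    · exact h.2 ξ hξ
    · rw [a.toFun_of_le hξ, b.toFun_of_le (hh ▸ hξ)]

theorem lt_iff {a b : CoherentTree δ t} :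
    a < b ↔ a.height < b.height ∧ ∀ ξ < a.height, a.toFun ξ = b.toFun ξ := by
  constructor
  · intro h
    refine ⟨lt_of_le_of_ne h.le.1 fun hh => h.not_ge ⟨hh.ge, fun ξ hξ => ?_⟩, h.le.2⟩
    exact (h.le.2 ξ (hh ▸ hξ)).symm
  · rintro ⟨h1, h2⟩
    exact lt_of_le_not_ge ⟨h1.le, h2⟩ fun h => h1.not_ge h.1

theorem height_strictMono : StrictMono (height : CoherentTree δ t → W) :=
  fun _ _ h => (lt_iff.1 h).1

theorem le_of_height_le {a b c : CoherentTree δ t} (hac : a ≤ c) (hbc : b ≤ c)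
    (h : a.height ≤ b.height) : a ≤ b :=
  ⟨h, fun ξ hξ => (hac.2 ξ hξ).trans (hbc.2 ξ (hξ.trans_le h)).symm⟩

/-- The initial segment of `a` of length at most `w`. -/
def restrict (a : CoherentTree δ t) (w : W) : CoherentTree δ t where
  height := min a.height w
  toFun ξ := if ξ < min a.height w then a.toFun ξ else 0
  exists_eq := by
    obtain ⟨x, hx, h⟩ := a.exists_eq
    refine ⟨x, (min_le_left _ _).trans hx, fun ξ => ?_⟩
    by_cases hξ : ξ < min a.height w
    · rw [if_pos hξ, if_pos hξ, h, if_pos (hξ.trans_le (min_le_left _ _))]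
    · rw [if_neg hξ, if_neg hξ]

theorem restrict_toFun (a : CoherentTree δ t) {w ξ : W} (h1 : ξ < a.height) (h2 : ξ < w) :
    (a.restrict w).toFun ξ = a.toFun ξ := if_pos (lt_min h1 h2)

theorem restrict_height (a : CoherentTree δ t) {w : W} (h : w ≤ a.height) :
    (a.restrict w).height = w := min_eq_right h

theorem restrict_lt (a : CoherentTree δ t) {w : W} (h : w < a.height) : a.restrict w < a := by
  refine lt_iff.2 ⟨(a.restrict_height h.le).trans_lt h, fun ξ hξ => ?_⟩
  rw [a.restrict_height h.le] at hξ
  exact a.restrict_toFun (hξ.trans h) hξ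

theorem finite_ne (hcoh : ∀ x y, {ξ | ξ < δ x ∧ ξ < δ y ∧ t x ξ ≠ t y ξ}.Finite)
    (a b : CoherentTree δ t) :
    {ξ | ξ < a.height ∧ ξ < b.height ∧ a.toFun ξ ≠ b.toFun ξ}.Finite := by
  obtain ⟨x, hx, ha⟩ := a.exists_eq
  obtain ⟨y, hy, hb⟩ := b.exists_eq
  refine (hcoh x y).subset ?_
  rintro ξ ⟨h1, h2, h3⟩
  rw [ha, hb, if_pos h1, if_pos h2] at h3
  exact ⟨h1.trans_le hx, h2.trans_le hy, h3⟩

theorem finite_fiber (hfin : ∀ x n, {ξ | ξ < δ x ∧ t x ξ = n}.Finite)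
    (a : CoherentTree δ t) (n : ℕ) : {ξ | ξ < a.height ∧ a.toFun ξ = n}.Finite := by
  obtain ⟨x, hx, ha⟩ := a.exists_eq
  refine (hfin x n).subset ?_
  rintro ξ ⟨h1, h2⟩
  rw [ha, if_pos h1] at h2
  exact ⟨h1.trans_le hx, h2⟩

theorem countable_level (hW : ∀ w : W, (Set.Iio w).Countable)
    (hcoh : ∀ x y, {ξ | ξ < δ x ∧ ξ < δ y ∧ t x ξ ≠ t y ξ}.Finite) (w : W) :
    {a : CoherentTree δ t | a.height = w}.Countable := by
  rcases Set.eq_empty_or_nonempty {a : CoherentTree δ t | a.height = w} with h | ⟨c, hc⟩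
  · rw [h]; exact Set.countable_empty
  have : Countable (Set.Iio w) := (hW w).to_subtype
  have hfin : ∀ a : CoherentTree δ t,
      {ξ : Set.Iio w | a.toFun ξ ≠ c.toFun ξ ∧ a.height = w}.Finite := by
    intro a
    refine Set.Finite.of_finite_image (f := Subtype.val) ((finite_ne hcoh a c).subset ?_)
      Subtype.val_injective.injOn
    rintro _ ⟨ξ, ⟨hne, ha⟩, rfl⟩
    exact ⟨ξ.2.trans_eq ha.symm, ξ.2.trans_eq (Eq.symm hc), hne⟩
  let code : CoherentTree δ t → Finset (Set.Iio w × ℕ) := fun a =>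
    (hfin a).toFinset.image fun ξ => (ξ, a.toFun ξ)
  refine Set.MapsTo.countable_of_injOn (t := Set.univ) (f := code) (Set.mapsTo_univ _ _) ?_
    (Set.to_countable _)
  have key : ∀ a b : CoherentTree δ t, a.height = w → b.height = w → code a = code b →
      ∀ ξ : Set.Iio w, a.toFun ξ ≠ c.toFun ξ → a.toFun ξ = b.toFun ξ := by
    intro a b ha hb hab ξ hξ
    have hmem : (ξ, a.toFun ξ) ∈ code a :=
      Finset.mem_image_of_mem _ ((hfin a).mem_toFinset.2 ⟨hξ, ha⟩)
    rw [hab] at hmem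
    obtain ⟨η, -, hη⟩ := Finset.mem_image.1 hmem
    obtain ⟨rfl, h2⟩ := Prod.mk.inj hη
    exact h2.symm
  intro a ha b hb hab
  have ha' : a.height = w := ha
  have hb' : b.height = w := hb
  refine CoherentTree.ext (ha'.trans hb'.symm) (funext fun ξ => ?_)
  rcases lt_or_ge ξ w with hξ | hξ
  · by_cases h1 : a.toFun ξ = c.toFun ξ
    · by_cases h2 : b.toFun ξ = c.toFun ξ
      · rw [h1, h2]
      · exact (key b a hb ha hab.symm ⟨ξ, hξ⟩ h2).symm
    · exact key a b ha hb hab ⟨ξ, hξ⟩ h1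
  · rw [a.toFun_of_le (ha'.trans_le hξ), b.toFun_of_le (hb'.trans_le hξ)]

theorem countable_height_mem (hlev : ∀ w, {a : CoherentTree δ t | a.height = w}.Countable)
    {s : Set W} (hs : s.Countable) : {a : CoherentTree δ t | a.height ∈ s}.Countable :=
  (hs.biUnion fun w _ => hlev w).mono fun a ha =>
    Set.mem_biUnion (t := fun w => {a : CoherentTree δ t | a.height = w}) (x := a.height) ha rfl

theorem mk_le (hlev : ∀ w, {a : CoherentTree δ t | a.height = w}.Countable)
    (hWc : Cardinal.mk W ≤ Cardinal.aleph.{u} 1) :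
    Cardinal.mk (CoherentTree δ t) ≤ Cardinal.aleph.{u} 1 := by
  choose e he using fun w => Set.countable_iff_exists_injOn.1 (hlev w)
  have hinj : Function.Injective
      fun a : CoherentTree δ t => (a.height, ULift.up.{u} (e a.height a)) := by
    intro a b hab
    obtain ⟨h1, h2⟩ := Prod.mk.inj hab
    rw [h1] at h2
    exact he b.height h1 rfl (ULift.up_injective h2)
  refine (Cardinal.mk_le_of_injective hinj).trans ?_
  have h0 : Cardinal.aleph0.{u} ≤ Cardinal.aleph 1 := Cardinal.aleph0_le_aleph 1
  simp only [Cardinal.mk_prod, Cardinal.lift_id, Cardinal.mk_uLift, Cardinal.mk_nat,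
    Cardinal.lift_aleph0]
  exact Cardinal.mul_le_of_le h0 hWc h0

end CoherentTree

theorem exists_upper_bound_of_countable (hWu : ¬ (Set.univ : Set W).Countable)
    (hW : ∀ w : W, (Set.Iio w).Countable) {s : Set W} (hs : s.Countable) :
    ∃ w, ∀ ξ ∈ s, ξ < w := by
  obtain ⟨w, -, hw⟩ := Set.exists_mem_of_not_countable hWu
    (hs.biUnion fun ξ _ => (Set.Iio_insert (a := ξ) ▸ (hW ξ).insert ξ : (Set.Iic ξ).Countable))
  refine ⟨w, fun ξ hξ => ?_⟩
  by_contra h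
  exact hw (Set.mem_biUnion hξ (not_lt.1 h))

/-- A weak pressing-down lemma: if a finite subset of `Set.Iio w` is attached to each `w`,
then uncountably many of these sets have a common bound. -/
theorem exists_uncountable_bounded [WellFoundedLT W] (hWu : ¬ (Set.univ : Set W).Countable)
    (hW : ∀ w : W, (Set.Iio w).Countable) (D : W → Set W) (hD : ∀ w, (D w).Finite)
    (hlt : ∀ w, ∀ ξ ∈ D w, ξ < w) : ∃ γ, ¬ {w | ∀ ξ ∈ D w, ξ < γ}.Countable := by
  by_contra! hcon
  choose b hb using fun γ => exists_upper_bound_of_countable hWu hW ((hcon γ).insert γ)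
  obtain ⟨w₀, -, -⟩ := Set.exists_mem_of_not_countable hWu Set.countable_empty
  let s : ℕ → W := fun n => b^[n] w₀
  have hs : ∀ n, s (n + 1) = b (s n) := fun n => Function.iterate_succ_apply' b n w₀
  have hmono : StrictMono s := strictMono_nat_of_lt_succ fun n => by
    rw [hs]; exact hb _ _ (Set.mem_insert _ _)
  obtain ⟨v, hv⟩ := exists_upper_bound_of_countable hWu hW (Set.countable_range s)
  obtain ⟨l, hl, hmin⟩ := WellFounded.has_min (wellFounded_lt (α := W)) {v | ∀ n, s n < v}
    ⟨v, fun n => hv _ ⟨n, rfl⟩⟩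
  have hcof : ∀ ξ, ∃ n, ξ < l → ξ < s n := by
    intro ξ
    by_cases hξ : ξ < l
    · by_contra! h
      refine hmin ξ (fun n => ?_) hξ
      exact (hmono (Nat.lt_succ_self n)).trans_le (h (n + 1)).2
    · exact ⟨0, fun h => absurd h hξ⟩
  choose N hN using hcof
  let M := (hD l).toFinset.sup N
  have hM : ∀ ξ ∈ D l, ξ < s M := fun ξ hξ =>
    (hN ξ (hlt l ξ hξ)).trans_le
      (hmono.monotone (Finset.le_sup ((hD l).mem_toFinset.2 hξ)))
  have h1 : l < s (M + 1) := by
    rw [hs]; exact hb _ l (Set.mem_insert_of_mem _ hM)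
  exact lt_asymm h1 (hl _)

namespace CoherentTree

theorem isNarrowTree (hWu : ¬ (Set.univ : Set W).Countable)
    (hW : ∀ w : W, (Set.Iio w).Countable)
    (hlev : ∀ w, {a : CoherentTree δ t | a.height = w}.Countable)
    (hfin : ∀ x n, {ξ | ξ < δ x ∧ t x ξ = n}.Finite) : IsNarrowTree (CoherentTree δ t) := by
  have hIic : ∀ w : W, (Set.Iic w).Countable := fun w =>
    Set.Iio_insert (a := w) ▸ (hW w).insert w
  refine ⟨fun a b c hac hbc => ?_, fun a => ?_, fun C hC => ?_⟩
  · rcases le_total a.height b.height with h | h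
    · exact Or.inl (le_of_height_le hac hbc h)
    · exact Or.inr (le_of_height_le hbc hac h)
  · exact (countable_height_mem hlev (hIic a.height)).mono fun b hb => hb.1
  · by_contra hCu
    have hex : ∀ w, ∃ c ∈ C, w < c.height := by
      intro w
      obtain ⟨c, hc, hcw⟩ := Set.exists_mem_of_not_countable hCu
        (countable_height_mem hlev (hIic w))
      exact ⟨c, hc, not_le.1 hcw⟩
    choose c hcC hc using hex
    obtain ⟨n, hn⟩ := exists_uncountable_fiber hWu fun ξ => (c ξ).toFun ξ
    have hinf : {ξ ∈ (Set.univ : Set W) | (c ξ).toFun ξ = n}.Infinite :=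
      fun h => hn h.countable
    let e := hinf.natEmbedding
    obtain ⟨w, hw⟩ := exists_upper_bound_of_countable hWu hW
      (Set.countable_range fun k => (e k : W))
    refine Set.infinite_range_of_injective (Subtype.val_injective.comp e.injective)
      ((finite_fiber hfin (c w) n).subset ?_)
    rintro _ ⟨k, rfl⟩
    have hk : (e k : W) < w := hw _ ⟨k, rfl⟩
    have hval : (c (e k)).toFun (e k) = n := (e k).2.2
    refine ⟨hk.trans (hc w), ?_⟩
    refine Eq.trans ?_ hval
    show (c w).toFun (e k) = (c (e k)).toFun (e k)
    by_cases heq : c w = c (e k)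
    · rw [heq]
    · rcases hC (hcC w) (hcC (e k)) heq with h | h
      · exact (lt_iff.1 h).2 _ (hk.trans (hc w))
      · exact ((lt_iff.1 h).2 _ (hc _)).symm

theorem exists_lipschitz [WellFoundedLT W] (hWu : ¬ (Set.univ : Set W).Countable)
    (hW : ∀ w : W, (Set.Iio w).Countable)
    (hcoh : ∀ x y, {ξ | ξ < δ x ∧ ξ < δ y ∧ t x ξ ≠ t y ξ}.Finite)
    (g : CoherentTree δ t → ℕ) (hg : ∀ a b, a < b → g a ≠ g b)
    (X : Set (CoherentTree δ t)) (hX : ¬ X.Countable) (f : CoherentTree δ t → CoherentTree δ t)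
    (hf : ∀ x ∈ X, (f x).height = x.height) :
    ∃ Y ⊆ X, ¬ Y.Countable ∧ ∀ x ∈ Y, ∀ y ∈ Y, x ≠ y → ∀ β,
      (∀ η < β, x.toFun η = y.toFun η) → ∀ η < β, (f x).toFun η = (f y).toFun η := by
  have hlev := countable_level hW hcoh
  have hex : ∀ w, ∃ x ∈ X, w ≤ x.height := by
    intro w
    obtain ⟨c, hc, hcw⟩ := Set.exists_mem_of_not_countable hX (countable_height_mem hlev (hW w))
    exact ⟨c, hc, not_lt.1 hcw⟩
  choose x hxX hx using hex
  have hfx : ∀ w, w ≤ (f (x w)).height := fun w => (hx w).trans_eq (hf _ (hxX w)).symm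
  let D : W → Set W := fun w => {ξ | ξ < w ∧ (x w).toFun ξ ≠ (f (x w)).toFun ξ}
  obtain ⟨γ, hγ⟩ := exists_uncountable_bounded hWu hW D
    (fun w => (finite_ne hcoh (x w) (f (x w))).subset fun ξ hξ =>
      ⟨hξ.1.trans_le (hx w), hξ.1.trans_le (hfx w), hξ.2⟩) (fun w ξ hξ => hξ.1)
  have : Countable {a : CoherentTree δ t // a.height ∈ Set.Iic γ} :=
    (countable_height_mem hlev (s := Set.Iic γ)
      (Set.Iio_insert (a := γ) ▸ (hW γ).insert γ)).to_subtype
  obtain ⟨⟨r, n⟩, hS⟩ := exists_uncountable_fiber hγ fun w =>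
    ((⟨(f (x w)).restrict γ, min_le_right _ _⟩ : {a : CoherentTree δ t // a.height ∈ Set.Iic γ}),
      g ((x w).restrict w))
  set S := {w ∈ {w | ∀ ξ ∈ D w, ξ < γ} | ((⟨(f (x w)).restrict γ, min_le_right _ _⟩ :
    {a : CoherentTree δ t // a.height ∈ Set.Iic γ}), g ((x w).restrict w)) = (r, n)}
  have hsplit : ∀ w ∈ S, ∀ w' ∈ S, w < w' → ∃ ξ < w, (x w).toFun ξ ≠ (x w').toFun ξ := by
    intro w hw w' hw' hlt
    by_contra! h
    refine hg ((x w).restrict w) ((x w').restrict w') (lt_iff.2 ⟨?_, fun ξ hξ => ?_⟩)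
      ((Prod.mk.inj hw.2).2.trans (Prod.mk.inj hw'.2).2.symm)
    · rwa [restrict_height _ (hx w), restrict_height _ (hx w')]
    · rw [restrict_height _ (hx w)] at hξ
      rw [restrict_toFun _ (hξ.trans_le (hx w)) hξ,
        restrict_toFun _ ((hξ.trans hlt).trans_le (hx w')) (hξ.trans hlt), h ξ hξ]
  have hlip : ∀ w ∈ S, ∀ w' ∈ S, w < w' → ∀ β, (∀ η < β, (x w).toFun η = (x w').toFun η) →
      ∀ η < β, (f (x w)).toFun η = (f (x w')).toFun η := by
    intro w hw w' hw' hlt β hβ η hη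
    obtain ⟨ξ, hξ, hne⟩ := hsplit w hw w' hw' hlt
    have hηw : η < w := hη.trans ((not_lt.1 fun h => hne (hβ ξ h)).trans_lt hξ)
    have hηw' := hηw.trans hlt
    rcases lt_or_ge η γ with hηγ | hηγ
    · have h1 : (f (x w)).restrict γ = (f (x w')).restrict γ :=
        congrArg Subtype.val ((Prod.mk.inj hw.2).1.trans (Prod.mk.inj hw'.2).1.symm)
      rw [← restrict_toFun _ (hηw.trans_le (hfx w)) hηγ, h1,
        restrict_toFun _ (hηw'.trans_le (hfx w')) hηγ]
    · have h1 : (x w).toFun η = (f (x w)).toFun η := by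
        by_contra h
        exact (hw.1 η ⟨hηw, h⟩).not_ge hηγ
      have h2 : (x w').toFun η = (f (x w')).toFun η := by
        by_contra h
        exact (hw'.1 η ⟨hηw', h⟩).not_ge hηγ
      rw [← h1, ← h2, hβ η hη]
  have hinj : Set.InjOn x S := by
    intro w hw w' hw' h
    by_contra hne
    rcases lt_or_gt_of_ne hne with hlt | hlt
    · obtain ⟨ξ, -, hξ⟩ := hsplit w hw w' hw' hlt
      exact hξ (by rw [h])
    · obtain ⟨ξ, -, hξ⟩ := hsplit w' hw' w hw hlt
      exact hξ (by rw [h])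
  refine ⟨x '' S, ?_, fun h => hS (Set.countable_of_injective_of_countable_image hinj h), ?_⟩
  · rintro _ ⟨w, -, rfl⟩
    exact hxX w
  · rintro _ ⟨w, hw, rfl⟩ _ ⟨w', hw', rfl⟩ hne β hβ η hη
    rcases lt_trichotomy w w' with hlt | rfl | hlt
    · exact hlip w hw w' hw' hlt β hβ η hη
    · exact absurd rfl hne
    · exact (hlip w' hw' w hw hlt β (fun η hη => (hβ η hη).symm) η hη).symm

end CoherentTree

end InitialSegments

section Trees

variable {T : Type u} [PartialOrder T]

theorem treeHeight_eq_type (hT : IsTree T) (x : T) :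
    treeHeight x = @Ordinal.type {y : T // y < x} (fun a b => (a : T) < b) (hT x) :=
  dif_pos (hT x)

theorem isWellOrder_common_predecessors (hT : IsTree T) (x y : T) :
    IsWellOrder {z : T // z < x ∧ z < y} (fun a b => (a : T) < (b : T)) := by
  have := hT x
  let e : (fun a b : {z : T // z < x ∧ z < y} => (a : T) < b) ↪r
      (fun a b : {z : T // z < x} => (a : T) < b) :=
    ⟨⟨fun z => ⟨z.1, z.2.1⟩, fun _ _ h => Subtype.ext (by simpa using h)⟩, Iff.rfl⟩
  exact e.isWellOrder

theorem treeDelta_eq_type (hT : IsTree T) (x y : T) :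
    treeDelta x y = @Ordinal.type {z : T // z < x ∧ z < y} (fun a b => (a : T) < b)
      (isWellOrder_common_predecessors hT x y) :=
  dif_pos (isWellOrder_common_predecessors hT x y)

theorem treeHeight_strictMono (hT : IsTree T) : StrictMono (treeHeight : T → Ordinal.{u}) := by
  intro x y hxy
  have := hT x
  have := hT y
  rw [treeHeight_eq_type hT, treeHeight_eq_type hT]
  refine lt_of_eq_of_lt ?_ (Ordinal.typein_lt_type (fun a b : {z : T // z < y} => (a : T) < b)
    ⟨x, hxy⟩)
  rw [← Ordinal.type_subrel]
  refine Ordinal.type_eq.2 ⟨⟨⟨fun z => ⟨⟨z.1, z.2.trans hxy⟩, z.2⟩, fun z => ⟨z.1.1, z.2⟩,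
    fun _ => rfl, fun _ => rfl⟩, Iff.rfl⟩⟩

theorem countable_of_type_lt_omega1 {α : Type u} (r : α → α → Prop) [IsWellOrder α r]
    (h : Ordinal.type r < omega1.{u}) : Countable α := by
  rw [omega1, Cardinal.lt_ord, Ordinal.card_type] at h
  rw [← Cardinal.mk_le_aleph0_iff, ← Order.lt_succ_iff, Cardinal.succ_aleph0]
  exact h

theorem IsWideAronszajn.isNarrowTree (hT : IsWideAronszajn T) : IsNarrowTree T := by
  refine ⟨fun x y z hxz hyz => ?_, fun x => ?_, hT.2.2.2⟩
  · have := hT.1 z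
    rcases hxz.eq_or_lt with rfl | hxz
    · exact Or.inr hyz
    rcases hyz.eq_or_lt with rfl | hyz
    · exact Or.inl hxz.le
    rcases trichotomous_of (fun a b : {w : T // w < z} => (a : T) < b) ⟨x, hxz⟩ ⟨y, hyz⟩
      with h | h | h
    · exact Or.inl h.le
    · exact Or.inl (congrArg Subtype.val h).le
    · exact Or.inr h.le
  · have := hT.1 x
    have h := hT.2.2.1.2 x
    rw [treeHeight_eq_type hT.1] at h
    have hc : Countable {y : T // y < x} := countable_of_type_lt_omega1 _ h
    exact Set.Iio_insert (a := x) ▸ (Set.countable_coe_iff.1 hc : (Set.Iio x).Countable).insert x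

end Trees

namespace CoherentTree

variable {T W : Type u} [LinearOrder W] {δ : T → W} {t : T → W → ℕ}

theorem lt_of_height_lt {a b c : CoherentTree δ t} (hac : a < c) (hbc : b < c)
    (h : a.height < b.height) : a < b :=
  lt_iff.2 ⟨h, (le_of_height_le hac.le hbc.le h.le).2⟩

/-- The predecessors of `a` are ordered as the initial segment of `W` below the height of `a`. -/
def predecessorsRelIso (a : CoherentTree δ t) :
    (fun b c : {b : CoherentTree δ t // b < a} => (b : CoherentTree δ t) < c) ≃r
      Subrel ((· < ·) : W → W → Prop) (· < a.height) where
  toFun b := ⟨b.1.height, height_strictMono b.2⟩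
  invFun w := ⟨a.restrict w.1, a.restrict_lt w.2⟩
  left_inv b := Subtype.ext (le_antisymm
    (le_of_height_le (a.restrict_lt (height_strictMono b.2)).le b.2.le
      (a.restrict_height b.2.le.1).le)
    (le_of_height_le b.2.le (a.restrict_lt (height_strictMono b.2)).le
      (a.restrict_height b.2.le.1).ge))
  right_inv w := Subtype.ext (a.restrict_height w.2.le)
  map_rel_iff' {b c} := ⟨fun h => lt_of_height_lt b.2 c.2 h, fun h => height_strictMono h⟩

/-- The node of the coherent tree given by the whole function attached to `x`. -/
def ofNode (δ : T → W) (t : T → W → ℕ) (x : T) : CoherentTree δ t where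
  height := δ x
  toFun ξ := if ξ < δ x then t x ξ else 0
  exists_eq := ⟨x, le_rfl, fun _ => rfl⟩

theorem isWeakEmbedding_ofNode [PartialOrder T] (hδ : StrictMono δ)
    (ht : ∀ x y, x < y → ∀ ξ < δ x, t x ξ = t y ξ) : IsWeakEmbedding (ofNode δ t) := by
  intro x y hxy
  refine lt_iff.2 ⟨hδ hxy, fun ξ (hξ : ξ < δ x) => ?_⟩
  exact (if_pos hξ).trans ((ht x y hxy ξ hξ).trans (if_pos (hξ.trans (hδ hxy))).symm)

variable [WellFoundedLT W]

theorem isTree : IsTree (CoherentTree δ t) := fun a =>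
  (predecessorsRelIso a).toRelEmbedding.isWellOrder

theorem treeHeight_eq (a : CoherentTree δ t) :
    treeHeight a = Ordinal.typein ((· < ·) : W → W → Prop) a.height := by
  have := isTree a
  rw [treeHeight_eq_type isTree, ← Ordinal.type_subrel]
  exact Ordinal.type_eq.2 ⟨predecessorsRelIso a⟩

theorem treeHeight_eq_iff {a b : CoherentTree δ t} :
    treeHeight a = treeHeight b ↔ a.height = b.height := by
  rw [treeHeight_eq, treeHeight_eq, Ordinal.typein_inj]

theorem treeDelta_le_treeDelta {a b a' b' : CoherentTree δ t} (ha : a.height = a'.height)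
    (hb : b.height = b'.height)
    (h : ∀ β, (∀ η < β, a.toFun η = b.toFun η) → ∀ η < β, a'.toFun η = b'.toFun η) :
    treeDelta a b ≤ treeDelta a' b' := by
  have := isWellOrder_common_predecessors isTree a b
  have := isWellOrder_common_predecessors isTree a' b'
  rw [treeDelta_eq_type isTree, treeDelta_eq_type isTree, Ordinal.type_le_iff']
  have hlt : ∀ c, c < a → c < b → a'.restrict c.height < a' ∧ a'.restrict c.height < b' := by
    intro c hca hcb
    have h1 : c.height < a'.height := ha ▸ height_strictMono hca
    have h2 : c.height < b'.height := hb ▸ height_strictMono hcb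
    refine ⟨a'.restrict_lt h1, lt_iff.2 ⟨?_, fun η hη => ?_⟩⟩
    · rwa [a'.restrict_height h1.le]
    · rw [a'.restrict_height h1.le] at hη
      rw [a'.restrict_toFun (hη.trans h1) hη]
      exact h c.height (fun η hη => (hca.le.2 η hη).symm.trans (hcb.le.2 η hη)) η hη
  have hheight : ∀ c : {c : CoherentTree δ t // c < a ∧ c < b},
      (a'.restrict c.1.height).height = c.1.height := fun c =>
    a'.restrict_height (ha ▸ c.2.1.le.1)
  refine ⟨RelEmbedding.ofMonotone (fun c => ⟨a'.restrict c.1.height, hlt c.1 c.2.1 c.2.2⟩)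
    fun c d hcd => ?_⟩
  refine lt_of_height_lt (hlt c.1 c.2.1 c.2.2).1 (hlt d.1 d.2.1 d.2.2).1 ?_
  rw [hheight, hheight]
  exact height_strictMono hcd

end CoherentTree

/-- Under MA(ω₁), every wide Aronszajn tree weakly embeds into a Lipschitz tree. -/
theorem wide_Aronszajn_embeds_into_Lipschitz (hMA : MAomega1.{u}) :
    ∀ (T : Type u) [PartialOrder T], IsWideAronszajn T →
      ∃ L : PoType.{u}, IsLipschitzTree L.carrier ∧
        ∃ f : T → L.carrier, IsWeakEmbedding f := by
  intro T _ hT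
  have hTn := hT.isNarrowTree
  let W : Type u := omega1.{u}.ToType
  have hWtype : Ordinal.type ((· < ·) : W → W → Prop) = omega1.{u} := Ordinal.type_toType _
  have hWcard : Cardinal.mk W = Cardinal.aleph.{u} 1 := by
    rw [Cardinal.mk_toType, omega1, Cardinal.card_ord]
  have hWu : ¬ (Set.univ : Set W).Countable := by
    rw [Set.countable_univ_iff, ← Cardinal.mk_le_aleph0_iff, hWcard, not_le]
    exact Cardinal.aleph0_lt_aleph_one
  have hW : ∀ w : W, (Set.Iio w).Countable := fun w => by
    have h : Ordinal.type (Subrel ((· < ·) : W → W → Prop) (· < w)) < omega1.{u} := by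
      rw [Ordinal.type_subrel]
      exact (Ordinal.typein_lt_type _ w).trans_eq hWtype
    have hc : Countable {v : W // v < w} := countable_of_type_lt_omega1 _ h
    exact Set.countable_coe_iff.1 hc
  have hsurj : ∀ o < omega1.{u}, ∃ w : W, Ordinal.typein ((· < ·) : W → W → Prop) w = o :=
    fun o ho => Ordinal.typein_surj _ (hWtype.symm ▸ ho)
  choose δ hδ using fun x : T => hsurj (treeHeight x) (hT.2.2.1.2 x)
  have hδm : StrictMono δ := fun x y hxy => by
    rw [← Ordinal.typein_lt_typein ((· < ·) : W → W → Prop), hδ, hδ]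
    exact treeHeight_strictMono hT.1 hxy
  have : Nonempty T := Cardinal.mk_ne_zero_iff.1 (hT.2.1 ▸ (Cardinal.aleph_pos 1).ne')
  have : Nonempty W := this.map δ
  obtain ⟨t, hmono, hcoh, hfin⟩ := hTn.exists_coherent hMA hT.2.1.le hWcard.le hW hδm
  have hlev := CoherentTree.countable_level hW hcoh
  have hLn := CoherentTree.isNarrowTree hWu hW hlev hfin
  obtain ⟨g, hg⟩ := hLn.exists_specializing hMA (CoherentTree.mk_le hlev hWcard.le)
  refine ⟨⟨CoherentTree δ t, inferInstance⟩, ⟨⟨CoherentTree.isTree, ⟨fun α hα => ?_, fun a => ?_⟩,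
    fun α => ?_, hLn.countable_of_chain⟩, fun X f hX hf => ?_⟩,
    CoherentTree.ofNode δ t, CoherentTree.isWeakEmbedding_ofNode hδm hmono⟩
  · obtain ⟨x, rfl⟩ := hT.2.2.1.1 α hα
    exact ⟨CoherentTree.ofNode δ t x, (CoherentTree.treeHeight_eq _).trans (hδ x)⟩
  · rw [CoherentTree.treeHeight_eq]
    exact (Ordinal.typein_lt_type _ _).trans_eq hWtype
  · by_cases hα : α < omega1.{u}
    · obtain ⟨w, rfl⟩ := hsurj α hα
      refine (hlev w).mono fun a (ha : treeHeight a = _) => ?_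
      rw [CoherentTree.treeHeight_eq, Ordinal.typein_inj] at ha
      exact ha
    · refine Set.countable_empty.mono fun a (ha : treeHeight a = α) => hα ?_
      rw [← ha, CoherentTree.treeHeight_eq]
      exact (Ordinal.typein_lt_type _ _).trans_eq hWtype
  · have hf' : ∀ x ∈ X, (f x).height = x.height := fun x hx =>
      CoherentTree.treeHeight_eq_iff.1 (hf x hx)
    obtain ⟨Y, hYX, hY, hlip⟩ := CoherentTree.exists_lipschitz hWu hW hcoh g hg X hX f hf'
    exact ⟨Y, hYX, hY, fun x hx y hy hxy => CoherentTree.treeDelta_le_treeDelta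
      (hf' x (hYX hx)).symm (hf' y (hYX hy)).symm (hlip x hx y hy hxy)⟩
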